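/- arXiv:math-ph/0509044 — 3 statements merged into one kernel-verified Lean document; each statement's English description precedes it below -/
import Mathlib

section
/- Let x_1,…,x_N be elements of a commutative ring (e.g., complex numbers). For 1 ≤ j, k ≤ N let A_{jk} = (−1)^j e_{j−1}(x_1,…,x_{k−1}, x_{k+1},…,x_N), the (j−1)-th elementary symmetric polynomial in the N−1 variables obtained by omitting x_k (with e_0 = 1). Then det A = (−1)^N ∏_{1≤j<k≤N} (x_k − x_j). -/
open Finset

theorem sum_powersetCard_succ_erase {R ι : Type*} [CommRing R] [DecidableEq ι] (t : Finset ι)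
    (x : ι → R) {k : ι} (hk : k ∈ t) (n : ℕ) :
    ∑ s ∈ powersetCard (n + 1) (t.erase k), ∏ i ∈ s, x i =
      ∑ s ∈ powersetCard (n + 1) t, ∏ i ∈ s, x i -
        x k * ∑ s ∈ powersetCard n (t.erase k), ∏ i ∈ s, x i := by
  have hk' : k ∉ t.erase k := notMem_erase k t
  have hnot {m : ℕ} {s : Finset ι} (hs : s ∈ powersetCard m (t.erase k)) : k ∉ s :=
    fun h => hk' ((mem_powersetCard.mp hs).1 h)
  conv_rhs => rw [← insert_erase hk, powersetCard_succ_insert hk', erase_insert hk']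
  rw [sum_union, sum_image, mul_sum, eq_sub_iff_add_eq]
  · congr 1
    exact sum_congr rfl fun s hs => (prod_insert (hnot hs)).symm
  · intro s hs u hu h
    rw [← erase_insert (hnot hs), ← erase_insert (hnot hu)]
    exact congrArg (fun v => v.erase k) h
  · refine disjoint_left.mpr fun s hs h => ?_
    obtain ⟨u, -, rfl⟩ := mem_image.mp h
    exact hnot hs (mem_insert_self k u)

/-- The elementary symmetric polynomials with one variable omitted, expanded in powers of
that variable. -/
theorem sum_powersetCard_erase {R ι : Type*} [CommRing R] [DecidableEq ι] (t : Finset ι)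
    (x : ι → R) {k : ι} (hk : k ∈ t) (n : ℕ) :
    ∑ s ∈ powersetCard n (t.erase k), ∏ i ∈ s, x i =
      ∑ m ∈ range (n + 1), (∑ s ∈ powersetCard (n - m) t, ∏ i ∈ s, x i) * (-x k) ^ m := by
  induction n with
  | zero => simp
  | succ n ih =>
    rw [sum_powersetCard_succ_erase t x hk, ih, sum_range_succ' _ (n + 1), mul_sum]
    simp only [Nat.add_sub_add_right, pow_succ, Nat.sub_zero, pow_zero, mul_one]
    rw [sub_eq_add_neg, add_comm, ← sum_neg_distrib]
    congr 1
    exact sum_congr rfl fun m _ => by ring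

/-- The lower triangular matrix that turns the powers `x k ^ i` into the derivatives
`∂a_j/∂x_k` of the coefficients of `∏ (X - x k)`. -/
def powersToJacobian {R : Type*} [CommRing R] {N : ℕ} (x : Fin N → R) :
    Matrix (Fin N) (Fin N) R :=
  Matrix.of fun j i => if i ≤ j then
    (-1) ^ ((j : ℕ) + 1) * (-1) ^ (i : ℕ) *
      ∑ s ∈ powersetCard ((j : ℕ) - i) univ, ∏ l ∈ s, x l else 0

theorem det_powersToJacobian {R : Type*} [CommRing R] {N : ℕ} (x : Fin N → R) :
    (powersToJacobian x).det = (-1) ^ N := by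
  rw [Matrix.det_of_isLowerTriangular]
  · have h (j : Fin N) : powersToJacobian x j j = -1 := by
      simp [powersToJacobian, pow_succ, ← mul_pow]
    simp [h]
  · intro i j hij
    exact if_neg (not_le.mpr hij)

/-- Equation (26) of Farmer–Mezzadri–Snaith:  the Jacobian matrix of the map from roots
to coefficients, with `(j,k)` entry `∂a_j/∂x_k = (-1)^j e_{j-1}(x_1,…,x̂_k,…,x_N)` (the
`(j-1)`-th elementary symmetric polynomial in the variables omitting `x_k`), has
determinant `(-1)^N ∏_{j<k} (x_k - x_j)`. -/
theorem statement10 {R : Type*} [CommRing R] (N : ℕ) (x : Fin N → R) :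
    (Matrix.of fun j k : Fin N =>
        (-1 : R) ^ ((j : ℕ) + 1) *
          ∑ s ∈ Finset.powersetCard (j : ℕ) (Finset.univ.erase k), ∏ i ∈ s, x i).det
    = (-1 : R) ^ N *
        ∏ p ∈ Finset.univ.filter (fun p : Fin N × Fin N => p.1 < p.2), (x p.2 - x p.1) := by
  have hA : (Matrix.of fun j k : Fin N =>
      (-1 : R) ^ ((j : ℕ) + 1) *
        ∑ s ∈ powersetCard (j : ℕ) (univ.erase k), ∏ i ∈ s, x i) =
      powersToJacobian x * (Matrix.vandermonde x).transpose := by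
    ext j k
    rw [Matrix.of_apply, sum_powersetCard_erase univ x (mem_univ k), mul_sum, Matrix.mul_apply]
    simp only [powersToJacobian, Matrix.of_apply, Matrix.transpose_apply,
      Matrix.vandermonde_apply, Fin.le_def]
    rw [Fin.sum_univ_eq_sum_range (fun m => (if m ≤ (j : ℕ) then
      (-1) ^ ((j : ℕ) + 1) * (-1) ^ m * ∑ s ∈ powersetCard ((j : ℕ) - m) univ, ∏ l ∈ s, x l
      else 0) * x k ^ m)]
    refine (sum_congr rfl fun m hm => ?_).trans
      (sum_subset (range_subset_range.mpr j.isLt) fun m _ hm => ?_)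
    · rw [if_pos (Nat.lt_succ_iff.mp (mem_range.mp hm)), neg_pow (x k)]
      ring
    · rw [if_neg fun h => hm (mem_range.mpr (Nat.lt_succ_of_le h)), zero_mul]
  rw [hA, Matrix.det_mul, Matrix.det_transpose, Matrix.det_vandermonde, det_powersToJacobian,
    prod_filter, ← univ_product_univ, prod_product]
  congr 1
  refine prod_congr rfl fun i _ => ?_
  rw [← prod_filter]
  congr 1
  ext j
  simp
end

section
/- Let M ≥ 1 and t_1,…,t_M ∈ ℝ. Let V be the M×M matrix whose (j,n) entry is (−1)^{n−1} cos((M − n + 1/2) t_j) for 1 ≤ j, n ≤ M. Then det V = 2^{M(M−1)/2} · ∏_{n=1}^M cos(t_n/2) · ∏_{1≤j<k≤M} (cos t_k − cos t_j). -/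
open Finset

open Polynomial in
/-- The rescaled Chebyshev polynomials of the third kind: the monic polynomials `V k` with
`cos ((k + 1/2) θ) = cos (θ/2) * V k (2 cos θ)`. -/
noncomputable def chebyshevThird : ℕ → ℝ[X]
  | 0 => 1
  | 1 => X - 1
  | k + 2 => X * chebyshevThird (k + 1) - chebyshevThird k

open Polynomial in
lemma chebyshevThird_monic_and_natDegree (k : ℕ) :
    (chebyshevThird k).Monic ∧ (chebyshevThird k).natDegree = k := by
  induction k using Nat.twoStepInduction with
  | zero => simp [chebyshevThird]
  | one => exact ⟨by simpa [chebyshevThird] using monic_X_sub_C (1 : ℝ),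
      by simpa [chebyshevThird] using natDegree_X_sub_C (1 : ℝ)⟩
  | more k ih ih' =>
    obtain ⟨hm, hd⟩ := ih
    obtain ⟨hm', hd'⟩ := ih'
    have hX : (X * chebyshevThird (k + 1)).natDegree = k + 2 := by
      rw [monic_X.natDegree_mul hm', natDegree_X, hd']
      ring
    have hlt : (chebyshevThird k).natDegree < (X * chebyshevThird (k + 1)).natDegree := by
      omega
    rw [chebyshevThird]
    exact ⟨(monic_X.mul hm').sub_of_left (degree_lt_degree hlt),
      by rw [natDegree_sub_eq_left_of_natDegree_lt hlt, hX]⟩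

lemma cos_half_mul_eval_chebyshevThird (k : ℕ) (θ : ℝ) :
    Real.cos (θ / 2) * (chebyshevThird k).eval (2 * Real.cos θ) =
      Real.cos ((k + 1 / 2) * θ) := by
  induction k using Nat.twoStepInduction with
  | zero =>
    simp only [chebyshevThird, Polynomial.eval_one]
    push_cast
    ring_nf
  | one =>
    have h := Real.cos_add_cos ((1 + 1 / 2) * θ) (θ / 2)
    rw [show ((1 + 1 / 2) * θ + θ / 2) / 2 = θ by ring,
      show ((1 + 1 / 2) * θ - θ / 2) / 2 = θ / 2 by ring] at h
    simp only [chebyshevThird, Polynomial.eval_sub, Polynomial.eval_X, Polynomial.eval_one]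
    push_cast
    linear_combination -h
  | more k ih ih' =>
    have h := Real.cos_add_cos (((k + 2 : ℕ) + 1 / 2) * θ) ((k + 1 / 2) * θ)
    rw [show ((((k + 2 : ℕ) : ℝ) + 1 / 2) * θ + (k + 1 / 2) * θ) / 2 =
        ((k + 1 : ℕ) + 1 / 2) * θ by push_cast; ring,
      show ((((k + 2 : ℕ) : ℝ) + 1 / 2) * θ - (k + 1 / 2) * θ) / 2 = θ by push_cast; ring] at h
    simp only [chebyshevThird, Polynomial.eval_sub, Polynomial.eval_mul, Polynomial.eval_X]
    linear_combination 2 * Real.cos θ * ih' - ih - h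

lemma prod_prod_Ioi_const {R : Type*} [CommMonoid R] (M : ℕ) (c : R) :
    ∏ i : Fin M, ∏ _j ∈ Ioi i, c = c ^ (M * (M - 1) / 2) := by
  simp_rw [prod_const, Fin.card_Ioi, prod_pow_eq_pow_sum]
  rw [Fin.sum_univ_eq_sum_range (fun i => M - 1 - i), sum_range_reflect (fun i => i), sum_range_id]

lemma prod_pow_fin_val {R : Type*} [CommMonoid R] (M : ℕ) (c : R) :
    ∏ i : Fin M, c ^ (i : ℕ) = c ^ (M * (M - 1) / 2) := by
  rw [prod_pow_eq_pow_sum, Fin.sum_univ_eq_sum_range (fun i => i), sum_range_id]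

lemma sign_revPerm (M : ℕ) :
    Equiv.Perm.sign (Fin.revPerm : Equiv.Perm (Fin M)) = (-1) ^ (M * (M - 1) / 2) := by
  rw [Equiv.Perm.sign_eq_prod_prod_Ioi, ← prod_prod_Ioi_const]
  refine prod_congr rfl fun i _ => prod_congr rfl fun j hj => ?_
  simp [(mem_Ioi.mp hj).le]

lemma det_vandermonde_const_mul {R : Type*} [CommRing R] {M : ℕ} (c : R) (v : Fin M → R) :
    (Matrix.vandermonde fun i => c * v i).det =
      c ^ (M * (M - 1) / 2) * (Matrix.vandermonde v).det := by
  simp_rw [Matrix.det_vandermonde, ← mul_sub, prod_mul_distrib, prod_prod_Ioi_const]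

lemma det_cos_half_integer {M : ℕ} (t : Fin M → ℝ) :
    (Matrix.of fun j k : Fin M => Real.cos (((k : ℕ) + 1 / 2) * t j)).det =
      (∏ j, Real.cos (t j / 2)) *
        (2 ^ (M * (M - 1) / 2) * (Matrix.vandermonde fun j => Real.cos (t j)).det) := by
  simp_rw [← cos_half_mul_eval_chebyshevThird]
  rw [← det_vandermonde_const_mul,
    Matrix.det_eval_matrixOfPolynomials_eq_det_vandermonde _ (fun k : Fin M => chebyshevThird k)
      (fun k => (chebyshevThird_monic_and_natDegree k).2)
      (fun k => (chebyshevThird_monic_and_natDegree k).1)]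
  exact Matrix.det_mul_column _ _


/-- The determinant identity (35) of Farmer–Mezzadri–Snaith for the matrix of
half-integer-frequency cosines: the `M × M` matrix with `(j,n)` entry
`(-1)^{n-1} cos((M - n + 1/2) t_j)` (here `j, n` are `1`-indexed) has determinant
`2^{M(M-1)/2} ∏_n cos(t_n/2) ∏_{j<k} (cos t_k - cos t_j)`. -/
theorem statement11 (M : ℕ) (hM : 1 ≤ M) (t : Fin M → ℝ) :
    (Matrix.of fun j n : Fin M =>
        (-1 : ℝ) ^ (n : ℕ) * Real.cos (((M : ℝ) - (n : ℕ) - 1 / 2) * t j)).det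
    = 2 ^ (M * (M - 1) / 2) * (∏ n, Real.cos (t n / 2)) *
        ∏ p ∈ Finset.univ.filter (fun p : Fin M × Fin M => p.1 < p.2),
          (Real.cos (t p.2) - Real.cos (t p.1)) := by
  have hrev : (Matrix.of fun j n : Fin M =>
      Real.cos (((M : ℝ) - (n : ℕ) - 1 / 2) * t j)) =
      (Matrix.of fun j k : Fin M => Real.cos (((k : ℕ) + 1 / 2) * t j)).submatrix id
        Fin.revPerm := by
    ext j n
    simp only [Matrix.of_apply, Matrix.submatrix_apply, id, Fin.revPerm_apply, Fin.val_rev]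
    rw [Nat.cast_sub (by omega)]
    push_cast
    ring_nf
  have hsign : ((-1 : ℝ) ^ (M * (M - 1) / 2)) * (-1) ^ (M * (M - 1) / 2) = 1 := by
    rw [← mul_pow]
    simp
  have hpairs : ∏ p ∈ univ.filter (fun p : Fin M × Fin M => p.1 < p.2),
      (Real.cos (t p.2) - Real.cos (t p.1)) =
      (Matrix.vandermonde fun j => Real.cos (t j)).det := by
    rw [Matrix.det_vandermonde]
    exact prod_finset_product _ _ _ (by simp)
  refine (Matrix.det_mul_row (fun n : Fin M => (-1 : ℝ) ^ (n : ℕ)) (Matrix.of fun j n : Fin M =>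
    Real.cos (((M : ℝ) - (n : ℕ) - 1 / 2) * t j))).trans ?_
  rw [hrev, Matrix.det_permute', sign_revPerm, prod_pow_fin_val, det_cos_half_integer, hpairs]
  push_cast
  rw [← mul_assoc, hsign]
  ring
end

section
/- Let M ≥ 1 and t_1,…,t_M ∈ ℝ. Let S be the M×M matrix whose (j,n) entry is sin((M + 1 − n) t_j) for 1 ≤ j, n ≤ M (so row j is (sin(M t_j), sin((M−1) t_j), …, sin(t_j))). Then det S = 2^{M(M−1)/2} · ∏_{j=1}^M sin(t_j) · ∏_{1≤j<k≤M} (cos t_j − cos t_k). -/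
open Finset

/-- If `p i` has degree at most `i`, the determinant of the matrix of values `(p j)(v i)` is the
Vandermonde determinant of `v` times the product of the coefficients of `X ^ i` in `p i`. -/
theorem det_eval_eq_det_vandermonde_mul_prod_coeff {R : Type*} [CommRing R] {n : ℕ}
    (v : Fin n → R) (p : Fin n → Polynomial R) (h_deg : ∀ i, (p i).natDegree ≤ i) :
    (Matrix.of fun i j => (p j).eval (v i)).det
      = (Matrix.vandermonde v).det * ∏ i : Fin n, (p i).coeff i := by
  rw [Matrix.eval_matrixOfPolynomials_eq_vandermonde_mul_matrixOfPolynomials v p h_deg,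
    Matrix.det_mul,
    Matrix.det_of_isUpperTriangular (Matrix.matrixOfPolynomials_blockTriangular p h_deg)]
  rfl

/-- The matrix of sines `sin((n + 1) t_j)` has a Vandermonde-type determinant in `cos t_j`. -/
theorem det_sin_succ_mul {M : ℕ} (s : Fin M → ℝ) :
    (Matrix.of fun j n : Fin M => Real.sin (((n : ℕ) + 1 : ℝ) * s j)).det
      = 2 ^ (M * (M - 1) / 2) * (∏ j, Real.sin (s j)) *
        (Matrix.vandermonde fun j => Real.cos (s j)).det := by
  have hentry : (Matrix.of fun j n : Fin M => Real.sin (((n : ℕ) + 1 : ℝ) * s j))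
      = Matrix.of fun j n : Fin M => Real.sin (s j) *
        (Matrix.of fun j n : Fin M =>
          (Polynomial.Chebyshev.U ℝ (n : ℕ)).eval (Real.cos (s j))) j n := by
    ext j n
    have h := Polynomial.Chebyshev.U_real_cos (s j) (n : ℕ)
    push_cast at h
    simp only [Matrix.of_apply]
    rw [← h, mul_comm]
  have hcoeff (n : ℕ) : (Polynomial.Chebyshev.U ℝ n).coeff n = 2 ^ n := by
    have h := Polynomial.Chebyshev.leadingCoeff_U_natCast ℝ n
    rwa [Polynomial.leadingCoeff, Polynomial.Chebyshev.natDegree_U_natCast] at h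
  rw [hentry, Matrix.det_mul_column, det_eval_eq_det_vandermonde_mul_prod_coeff _ _
    fun i => (Polynomial.Chebyshev.natDegree_U_natCast ℝ i).le]
  simp only [hcoeff]
  rw [Fin.prod_univ_eq_prod_range (fun n => (2 : ℝ) ^ n), Finset.prod_pow_eq_pow_sum,
    Finset.sum_range_id]
  ring

/-- The determinant identity used in Farmer–Mezzadri–Snaith for the matrix of sines: the
`M × M` matrix whose `j`-th row is `(sin(M t_j), sin((M-1) t_j), …, sin(t_j))`, i.e. with
`(j,n)` entry `sin((M + 1 - n) t_j)` for `1`-indexed `j, n`, has determinant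
`2^{M(M-1)/2} ∏_j sin(t_j) ∏_{j<k} (cos t_j - cos t_k)`. -/
theorem statement12 (M : ℕ) (hM : 1 ≤ M) (t : Fin M → ℝ) :
    (Matrix.of fun j n : Fin M => Real.sin (((M : ℝ) - (n : ℕ)) * t j)).det
    = 2 ^ (M * (M - 1) / 2) * (∏ j, Real.sin (t j)) *
        ∏ p ∈ Finset.univ.filter (fun p : Fin M × Fin M => p.1 < p.2),
          (Real.cos (t p.1) - Real.cos (t p.2)) := by
  have hrev : (Matrix.of fun j n : Fin M => Real.sin (((M : ℝ) - (n : ℕ)) * t j)).submatrix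
      Fin.revPerm Fin.revPerm
      = Matrix.of fun j n : Fin M => Real.sin (((n : ℕ) + 1 : ℝ) * t (Fin.rev j)) := by
    ext j n
    have hn : n.val + 1 ≤ M := n.isLt
    simp only [Matrix.submatrix_apply, Matrix.of_apply, Fin.revPerm_apply, Fin.val_rev,
      Nat.cast_sub hn]
    push_cast
    ring_nf
  rw [← Matrix.det_submatrix_equiv_self Fin.revPerm, hrev, det_sin_succ_mul,
    Matrix.det_vandermonde]
  congr 1
  · congr 1
    exact Equiv.prod_comp Fin.revPerm fun j => Real.sin (t j)
  · rw [← Finset.prod_finset_product' (Finset.univ.filter fun p : Fin M × Fin M => p.1 < p.2)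
      Finset.univ (fun i => Finset.Ioi i) (by simp)
      (f := fun i j => Real.cos (t (Fin.rev j)) - Real.cos (t (Fin.rev i)))]
    refine Finset.prod_nbij' (fun p => (Fin.rev p.2, Fin.rev p.1))
      (fun p => (Fin.rev p.2, Fin.rev p.1)) ?_ ?_ ?_ ?_ ?_ <;> simp
end
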